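/- The Dicke state |D⟩_4^2 = (1/√6) Σ_{x ∈ {0,1}^4, wt(x)=2} |x⟩ (the uniform superposition over the six 4-bit strings of Hamming weight 2) can be prepared from the ground state by a circuit containing at most 6 CNOT gates: γ(|0⟩, |D⟩_4^2) ≤ 6. -/

import Mathlib

open scoped BigOperators

/-- Bit strings of length `n`, identified with indices of `ℂ^(2^n)`. -/
abbrev BString (n : ℕ) := Fin n → Bool

/-- An `n`-qubit (complex) amplitude vector. -/
abbrev QState (n : ℕ) := BString n → ℂ

/-- `ψ` is an `n`-qubit state: a unit vector. -/
def IsQState {n : ℕ} (ψ : QState n) : Prop := ∑ x, Complex.normSq (ψ x) = 1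

/-- Flip bit `t` of `y` whenever bit `c` of `y` is `1`. -/
def cnotFun {n : ℕ} (c t : Fin n) (y : BString n) : BString n :=
  Function.update y t (xor (y t) (y c))

/-- A gate: either a single-qubit gate on qubit `i` with 2×2 matrix `V`,
or a CNOT gate with control `c` and target `t`. -/
inductive Gate (n : ℕ) where
  | single (i : Fin n) (V : Matrix Bool Bool ℂ) : Gate n
  | cnot (c t : Fin n) : Gate n

/-- The unitary on `ℂ^(2^n)` implemented by a gate.  A single-qubit gate on
qubit `i` is the Kronecker product `I ⊗ V ⊗ I` acting on qubit `i`; a CNOT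
permutes basis vectors by flipping bit `t` when bit `c` is `1`. -/
def Gate.matrix {n : ℕ} : Gate n → Matrix (BString n) (BString n) ℂ
  | .single i V => fun x y => if ∀ j, j ≠ i → x j = y j then V (x i) (y i) else 0
  | .cnot c t => fun x y => if x = cnotFun c t y then 1 else 0

/-- Validity: `V ∈ U(2)` for single-qubit gates, `c ≠ t` for CNOTs. -/
def Gate.Valid {n : ℕ} : Gate n → Prop
  | .single _ V => V ∈ Matrix.unitaryGroup Bool ℂ
  | .cnot c t => c ≠ t

def Gate.isCnot {n : ℕ} : Gate n → Bool
  | .single _ _ => false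
  | .cnot _ _ => true

/-- A circuit: a finite sequence of gates (applied left to right). -/
abbrev Circuit (n : ℕ) := List (Gate n)

def Circuit.Valid {n : ℕ} (C : Circuit n) : Prop := ∀ g ∈ C, g.Valid

/-- The CNOT count of a circuit. -/
def Circuit.cnotCount {n : ℕ} (C : Circuit n) : ℕ := (C.filter Gate.isCnot).length

/-- Apply a circuit `C = [U₁, …, U_l]` to a state: result is `U_l ⋯ U₂ U₁ ψ`. -/
noncomputable def Circuit.apply {n : ℕ} (C : Circuit n) (ψ : QState n) : QState n :=
  C.foldl (fun v g => g.matrix.mulVec v) ψ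

/-- The composed product `U_l ⋯ U₂ U₁` of a circuit `C = [U₁, …, U_l]`. -/
noncomputable def Circuit.matrix {n : ℕ} (C : Circuit n) : Matrix (BString n) (BString n) ℂ :=
  ((C.map Gate.matrix).reverse).prod

/-- `γ(ψ,φ) ∈ ℕ∞`: the infimum over valid circuits mapping `ψ` to `φ`
of the CNOT count (`⊤` if no such circuit exists). -/
noncomputable def gamma {n : ℕ} (ψ φ : QState n) : ℕ∞ :=
  ⨅ (C : {C : Circuit n // C.Valid ∧ C.apply ψ = φ}), (C.1.cnotCount : ℕ∞)

/-- `Δ(U) ∈ ℕ∞`: the CNOT cost of a unitary `U`, the infimum over valid circuits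
whose composed product is `U` of the CNOT count. -/
noncomputable def Delta {n : ℕ} (U : Matrix (BString n) (BString n) ℂ) : ℕ∞ :=
  ⨅ (C : {C : Circuit n // C.Valid ∧ C.matrix = U}), (C.1.cnotCount : ℕ∞)

/-- The ground state `|0⟩`. -/
def groundState (n : ℕ) : QState n := fun x => if x = fun _ => false then 1 else 0

/-- The Dicke state `|D⟩₄²`: the uniform superposition (amplitude `1/√6`)
over the six 4-bit strings of Hamming weight 2. -/
noncomputable def dicke42 : QState 4 := fun x =>
  if (Finset.univ.filter (fun i => x i = true)).card = 2
  then ((1 : ℂ) / (Real.sqrt 6 : ℂ)) else 0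

/-- The real realRotation with first column `(p, q)`. -/
def realRotation (p q : ℝ) : Matrix Bool Bool ℂ := fun i j =>
  match i, j with
  | false, false => p
  | false, true => -q
  | true, false => q
  | true, true => p

theorem realRotation_mem_unitaryGroup {p q : ℝ} (h : p ^ 2 + q ^ 2 = 1) :
    realRotation p q ∈ Matrix.unitaryGroup Bool ℂ := by
  have h' : (p : ℂ) ^ 2 + (q : ℂ) ^ 2 = 1 := by exact_mod_cast h
  rw [Matrix.mem_unitaryGroup_iff]
  ext i j
  cases i <;> cases j <;>
    simp [Matrix.mul_apply, realRotation, Matrix.star_apply] <;> grind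

theorem single_matrix_mulVec {n : ℕ} (i : Fin n) (V : Matrix Bool Bool ℂ) (ψ : QState n)
    (x : BString n) :
    ((Gate.single i V).matrix.mulVec ψ) x =
      V (x i) false * ψ (Function.update x i false) +
        V (x i) true * ψ (Function.update x i true) := by
  have hne : Function.update x i false ≠ Function.update x i true := fun h => by
    simpa using congrFun h i
  rw [Matrix.mulVec, dotProduct,
    ← Finset.sum_subset (Finset.subset_univ {Function.update x i false, Function.update x i true}),
    Finset.sum_pair hne]
  · have h (b : Bool) : ∀ j, j ≠ i → x j = Function.update x i b j := fun j hj => by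
      simp [hj]
    simp only [Gate.matrix, if_pos (h _), Function.update_self]
  · intro y _ hy
    have hxy : ¬ ∀ j, j ≠ i → x j = y j := by
      intro h
      have hupd : y = Function.update x i (y i) := by
        rw [Function.eq_update_iff]
        exact ⟨rfl, fun j hj => (h j hj).symm⟩
      rcases hb : y i <;> rw [hb] at hupd <;> simp [← hupd] at hy
    simp only [Gate.matrix, if_neg hxy, zero_mul]

theorem cnotFun_cnotFun {n : ℕ} {c t : Fin n} (h : c ≠ t) (x : BString n) :
    cnotFun c t (cnotFun c t x) = x := by
  simp [cnotFun, h]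

theorem cnot_matrix_mulVec {n : ℕ} {c t : Fin n} (h : c ≠ t) (ψ : QState n) (x : BString n) :
    ((Gate.cnot c t).matrix.mulVec ψ) x = ψ (cnotFun c t x) := by
  have key (y : BString n) : x = cnotFun c t y ↔ y = cnotFun c t x :=
    ⟨fun e => by rw [e, cnotFun_cnotFun h], fun e => by rw [e, cnotFun_cnotFun h]⟩
  simp [Matrix.mulVec, dotProduct, Gate.matrix, key]

/-- A four-qubit state given by its amplitudes as a function of the four bits. -/
def ofAmplitudes (f : Bool → Bool → Bool → Bool → ℂ) : QState 4 :=
  fun x => f (x 0) (x 1) (x 2) (x 3)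

section FourQubits

variable (f : Bool → Bool → Bool → Bool → ℂ) (V : Matrix Bool Bool ℂ)

theorem single_zero_mulVec_ofAmplitudes :
    (Gate.single 0 V).matrix.mulVec (ofAmplitudes f) = ofAmplitudes fun a b c d =>
      V a false * f false b c d + V a true * f true b c d := by
  ext x
  simp [single_matrix_mulVec, ofAmplitudes]

theorem single_one_mulVec_ofAmplitudes :
    (Gate.single 1 V).matrix.mulVec (ofAmplitudes f) = ofAmplitudes fun a b c d =>
      V b false * f a false c d + V b true * f a true c d := by
  ext x
  simp [single_matrix_mulVec, ofAmplitudes]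

theorem single_two_mulVec_ofAmplitudes :
    (Gate.single 2 V).matrix.mulVec (ofAmplitudes f) = ofAmplitudes fun a b c d =>
      V c false * f a b false d + V c true * f a b true d := by
  ext x
  simp [single_matrix_mulVec, ofAmplitudes]

theorem cnot_one_zero_mulVec_ofAmplitudes :
    (Gate.cnot 1 0).matrix.mulVec (ofAmplitudes f) =
      ofAmplitudes fun a b c d => f (xor a b) b c d := by
  ext x
  simp [cnot_matrix_mulVec, ofAmplitudes, cnotFun]

theorem cnot_zero_one_mulVec_ofAmplitudes :
    (Gate.cnot 0 1).matrix.mulVec (ofAmplitudes f) =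
      ofAmplitudes fun a b c d => f a (xor b a) c d := by
  ext x
  simp [cnot_matrix_mulVec, ofAmplitudes, cnotFun]

theorem cnot_zero_two_mulVec_ofAmplitudes :
    (Gate.cnot 0 2).matrix.mulVec (ofAmplitudes f) =
      ofAmplitudes fun a b c d => f a b (xor c a) d := by
  ext x
  simp [cnot_matrix_mulVec, ofAmplitudes, cnotFun]

theorem cnot_one_three_mulVec_ofAmplitudes :
    (Gate.cnot 1 3).matrix.mulVec (ofAmplitudes f) =
      ofAmplitudes fun a b c d => f a b c (xor d b) := by
  ext x
  simp [cnot_matrix_mulVec, ofAmplitudes, cnotFun]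

theorem cnot_two_three_mulVec_ofAmplitudes :
    (Gate.cnot 2 3).matrix.mulVec (ofAmplitudes f) =
      ofAmplitudes fun a b c d => f a b c (xor d c) := by
  ext x
  simp [cnot_matrix_mulVec, ofAmplitudes, cnotFun]

end FourQubits

theorem groundState_four_eq_ofAmplitudes :
    groundState 4 = ofAmplitudes fun a b c d => if a || b || c || d then 0 else 1 := by
  ext x
  have h : (x = fun _ => false) ↔ (x 0 || x 1 || x 2 || x 3) = false := by
    simp [funext_iff, Fin.forall_fin_succ, and_assoc]
  by_cases hx : x = fun _ => false
  · simp [groundState, ofAmplitudes, hx]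
  · have h' := Bool.eq_true_of_not_eq_false (mt h.mpr hx)
    simp only [groundState, ofAmplitudes, if_neg hx, if_pos h']

theorem dicke42_eq_ofAmplitudes :
    dicke42 = ofAmplitudes fun a b c d =>
      if a.toNat + b.toNat + c.toNat + d.toNat = 2 then (((√6)⁻¹ : ℝ) : ℂ) else 0 := by
  ext x
  have h : (Finset.univ.filter (fun i => x i = true)).card =
      (x 0).toNat + (x 1).toNat + (x 2).toNat + (x 3).toNat := by
    rw [Finset.card_filter, Fin.sum_univ_four]
    cases x 0 <;> cases x 1 <;> cases x 2 <;> cases x 3 <;> rfl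
  simp [dicke42, ofAmplitudes, h]

/-- A Schmidt-form preparation across qubits `0, 1 | 2, 3`: prepare
`(|00⟩ - |10⟩ + 2|01⟩)/√6` on qubits `0, 1`, copy it to qubits `2, 3`, and rotate both pairs to
the Bell basis. The parameters are meant to be `r = 1/√6`, `h = 1/√2`, `c = cos (π/8)`,
`s = sin (π/8)`. -/
noncomputable def dickeCircuit (r h c s : ℝ) : Circuit 4 :=
  [.single 1 (realRotation (2 * h * r) (2 * r)), .single 0 (realRotation c s), .cnot 1 0,
    .single 0 (realRotation s (-c)), .cnot 0 2, .cnot 1 3,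
    .single 0 (realRotation h h), .single 2 (realRotation h h), .cnot 0 1, .cnot 2 3]

theorem dickeCircuit_valid {r h c s : ℝ} (hr : 6 * r ^ 2 = 1) (hh : 2 * h ^ 2 = 1)
    (hcs : c ^ 2 + s ^ 2 = 1) : (dickeCircuit r h c s).Valid := by
  have h₁ : (2 * h * r) ^ 2 + (2 * r) ^ 2 = 1 := by linear_combination 2 * r ^ 2 * hh + hr
  have h₂ : s ^ 2 + (-c) ^ 2 = 1 := by linear_combination hcs
  have h₃ : h ^ 2 + h ^ 2 = 1 := by linear_combination hh
  simp [Circuit.Valid, dickeCircuit, Gate.Valid, realRotation_mem_unitaryGroup h₁,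
    realRotation_mem_unitaryGroup h₂, realRotation_mem_unitaryGroup h₃,
    realRotation_mem_unitaryGroup hcs]

theorem dickeCircuit_apply_groundState {h c s : ℝ} (hh : 2 * h ^ 2 = 1)
    (hcs : c ^ 2 + s ^ 2 = 1) (hsub : c ^ 2 - s ^ 2 = h) (hmul : 2 * c * s = h) :
    (dickeCircuit (√6)⁻¹ h c s).apply (groundState 4) = dicke42 := by
  rw [groundState_four_eq_ofAmplitudes, dicke42_eq_ofAmplitudes]
  simp only [dickeCircuit, Circuit.apply, List.foldl_cons, List.foldl_nil,
    single_zero_mulVec_ofAmplitudes, single_one_mulVec_ofAmplitudes,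
    single_two_mulVec_ofAmplitudes, cnot_one_zero_mulVec_ofAmplitudes,
    cnot_zero_one_mulVec_ofAmplitudes, cnot_zero_two_mulVec_ofAmplitudes,
    cnot_one_three_mulVec_ofAmplitudes, cnot_two_three_mulVec_ofAmplitudes]
  generalize (√6)⁻¹ = r
  replace hh : 2 * (h : ℂ) ^ 2 = 1 := by exact_mod_cast hh
  replace hcs : (c : ℂ) ^ 2 + (s : ℂ) ^ 2 = 1 := by exact_mod_cast hcs
  replace hsub : (c : ℂ) ^ 2 - (s : ℂ) ^ 2 = h := by exact_mod_cast hsub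
  replace hmul : 2 * (c : ℂ) * s = h := by exact_mod_cast hmul
  congr 1
  ext a b x y
  cases a <;> cases b <;> cases x <;> cases y <;> simp [realRotation] <;> grind

/-- the Dicke state `|D⟩₄²` can be prepared from the ground
state by a circuit containing at most 6 CNOT gates: `γ(|0⟩, |D⟩₄²) ≤ 6`. -/
theorem gamma_dicke42_le_six : gamma (groundState 4) dicke42 ≤ 6 := by
  have hr : 6 * ((√6)⁻¹ : ℝ) ^ 2 = 1 := by
    rw [inv_pow, Real.sq_sqrt (by norm_num)]
    norm_num
  have hh : 2 * (√2 / 2) ^ 2 = (1 : ℝ) := by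
    rw [div_pow, Real.sq_sqrt (by norm_num)]
    norm_num
  have hangle : 2 * (Real.pi / 8) = Real.pi / 4 := by ring
  have hcs := Real.cos_sq_add_sin_sq (Real.pi / 8)
  have hsub : Real.cos (Real.pi / 8) ^ 2 - Real.sin (Real.pi / 8) ^ 2 = √2 / 2 := by
    rw [← Real.cos_two_mul', hangle, Real.cos_pi_div_four]
  have hmul : 2 * Real.cos (Real.pi / 8) * Real.sin (Real.pi / 8) = √2 / 2 := by
    rw [mul_right_comm, ← Real.sin_two_mul, hangle, Real.sin_pi_div_four]
  refine (iInf_le _ ⟨_, dickeCircuit_valid hr hh hcs,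
    dickeCircuit_apply_groundState hh hcs hsub hmul⟩).trans ?_
  simp only [dickeCircuit, Circuit.cnotCount, List.filter, Gate.isCnot, List.length]
  norm_num
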